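/- Let α be a real number with −1/2 < α < 1/2 and α ≠ 0, let ε > 0 and t ≥ 0. Then ∫₀ᵗ ((t−s+ε)^α − (t−s)^α)² ds ≤ C(α) · ε^{1+2α}, where C(α) = ∫₀^∞ ((v+1)^α − v^α)² dv. In particular the bound is uniform in t ∈ [0, T] for any T > 0. -/

import Mathlib

theorem fk_integrable (α : ℝ) (hα₁ : -(1/2 : ℝ) < α) (hα₂ : α < 1/2) :
    MeasureTheory.IntegrableOn (fun v : ℝ => ((v + 1) ^ α - v ^ α) ^ 2) (Set.Ioi (0:ℝ)) := by
  have hm : Measurable (fun v : ℝ => ((v + 1) ^ α - v ^ α) ^ 2) := by fun_prop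
  rw [← Set.Ioc_union_Ioi_eq_Ioi (zero_le_one' ℝ)]
  apply MeasureTheory.IntegrableOn.union
  · have h1 : MeasureTheory.IntegrableOn (fun v : ℝ => 8 + 2 * v ^ (2 * α)) (Set.Ioc 0 1) := by
      rw [← intervalIntegrable_iff_integrableOn_Ioc_of_le (zero_le_one' ℝ)]
      exact intervalIntegrable_const.add
        ((intervalIntegral.intervalIntegrable_rpow' (by linarith)).const_mul 2)
    refine MeasureTheory.Integrable.mono' h1 hm.aestronglyMeasurable ?_
    refine (MeasureTheory.ae_restrict_iff' measurableSet_Ioc).2 (Filter.Eventually.of_forall ?_)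
    intro v hv
    have hv0 : 0 < v := hv.1
    have hv1 : v ≤ 1 := hv.2
    rw [Real.norm_of_nonneg (sq_nonneg _)]
    have e : v ^ (2 * α) = (v ^ α) ^ 2 := by
      rw [mul_comm, Real.rpow_mul hv0.le]; norm_num
    have b : (v + 1) ^ α ≤ 2 := by
      calc (v + 1) ^ α ≤ (v + 1) ^ (1:ℝ) :=
            Real.rpow_le_rpow_of_exponent_le (by linarith) (by linarith)
        _ ≤ 2 := by rw [Real.rpow_one]; linarith
    have b0 : 0 ≤ (v + 1) ^ α := by positivity
    rw [e]
    nlinarith [sq_nonneg ((v + 1) ^ α + v ^ α)]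
  · have h1 : MeasureTheory.IntegrableOn (fun v : ℝ => v ^ (2 * α - 2)) (Set.Ioi 1) :=
      integrableOn_Ioi_rpow_of_lt (by linarith) one_pos
    refine MeasureTheory.Integrable.mono' h1 hm.aestronglyMeasurable ?_
    refine (MeasureTheory.ae_restrict_iff' measurableSet_Ioi).2 (Filter.Eventually.of_forall ?_)
    intro v hv
    have hv0 : 0 < v := lt_trans one_pos hv
    rw [Real.norm_of_nonneg (sq_nonneg _)]
    have e : v ^ (2 * α - 2) = (v ^ (α - 1)) ^ 2 := by
      rw [show 2 * α - 2 = (α - 1) * 2 by ring, Real.rpow_mul hv0.le]; norm_num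
    have key : ‖(v + 1) ^ α - v ^ α‖ ≤ v ^ (α - 1) * ‖(v + 1) - v‖ := by
      refine Convex.norm_image_sub_le_of_norm_hasDerivWithin_le (s := Set.Icc v (v + 1))
        (f := fun x : ℝ => x ^ α) (f' := fun x : ℝ => α * x ^ (α - 1)) ?_ ?_ (convex_Icc _ _)
        (by simp) (by simp)
      · intro x hx
        exact (Real.hasDerivAt_rpow_const (Or.inl (by linarith [hx.1]))).hasDerivWithinAt
      · intro x hx
        have hx0 : 0 < x := lt_of_lt_of_le hv0 hx.1
        have hp : 0 ≤ x ^ (α - 1) := by positivity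
        rw [norm_mul, Real.norm_of_nonneg hp]
        have ha : ‖α‖ ≤ 1 := by rw [Real.norm_eq_abs, abs_le]; constructor <;> linarith
        calc ‖α‖ * x ^ (α - 1) ≤ 1 * x ^ (α - 1) := by gcongr
          _ = x ^ (α - 1) := one_mul _
          _ ≤ v ^ (α - 1) := Real.rpow_le_rpow_of_nonpos hv0 hx.1 (by linarith)
    rw [e, ← sq_abs]
    have : |(v + 1) ^ α - v ^ α| ≤ v ^ (α - 1) := by simpa using key
    gcongr

/-- The paper's key estimate (2.5): for `α ∈ (−1/2, 1/2)`, `α ≠ 0`, `ε > 0` and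
`t ≥ 0`, `∫₀ᵗ ((t−s+ε)^α − (t−s)^α)² ds ≤ C(α)·ε^{1+2α}` with
`C(α) = ∫₀^∞ ((v+1)^α − v^α)² dv`; the bound does not depend on `t`. -/
theorem fractional_kernel_L2_estimate
    (α : ℝ) (hα₁ : -(1/2 : ℝ) < α) (hα₂ : α < 1/2) (hα0 : α ≠ 0)
    (ε : ℝ) (hε : 0 < ε) (t : ℝ) (ht : 0 ≤ t) :
    (∫ s in (0:ℝ)..t, ((t - s + ε) ^ α - (t - s) ^ α) ^ 2) ≤
      (∫ v in Set.Ioi (0:ℝ), ((v + 1) ^ α - v ^ α) ^ 2) * ε ^ (1 + 2 * α) := by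
  have hi := fk_integrable α hα₁ hα₂
  have h1 := intervalIntegral.integral_comp_sub_left (a := 0) (b := t)
    (fun u : ℝ => ((u + ε) ^ α - u ^ α) ^ 2) t
  have h2 := intervalIntegral.mul_integral_comp_mul_left (a := 0) (b := t / ε)
    (f := fun u : ℝ => ((u + ε) ^ α - u ^ α) ^ 2) ε
  rw [mul_zero, mul_div_cancel₀ _ hε.ne'] at h2
  simp only [sub_self, sub_zero] at h1
  rw [h1, ← h2]
  have hT : 0 ≤ t / ε := by positivity
  have h3 : (∫ x in (0:ℝ)..(t / ε), ((ε * x + ε) ^ α - (ε * x) ^ α) ^ 2) =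
      ∫ x in (0:ℝ)..(t / ε), ε ^ (2 * α) * ((x + 1) ^ α - x ^ α) ^ 2 := by
    apply intervalIntegral.integral_congr
    intro x hx
    rw [Set.uIcc_of_le hT] at hx
    have hx0 : 0 ≤ x := hx.1
    have e : ε ^ (2 * α) = (ε ^ α) ^ 2 := by
      rw [mul_comm, Real.rpow_mul hε.le]; norm_num
    simp only
    rw [show ε * x + ε = ε * (x + 1) by ring, Real.mul_rpow hε.le (by linarith),
      Real.mul_rpow hε.le hx0, e]
    ring
  rw [h3, intervalIntegral.integral_const_mul, ← mul_assoc, Real.rpow_add hε, Real.rpow_one,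
    mul_comm]
  refine mul_le_mul_of_nonneg_right ?_ (by positivity)
  rw [intervalIntegral.integral_of_le hT]
  exact MeasureTheory.setIntegral_mono_set hi (Filter.Eventually.of_forall fun _ => sq_nonneg _)
    (HasSubset.Subset.eventuallyLE Set.Ioc_subset_Ioi_self)
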